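/- For every g ∈ K[x] there is a unique automorphism Δ_g ∈ Aut(P_λ) with Δ_g(e) = e − g(f)h − f·g(f)², Δ_g(h) = h + 2f·g(f), and Δ_g(f) = f (in particular this assignment is a well-defined K-algebra automorphism preserving the bracket); moreover Δ_{g₁}∘Δ_{g₂} = Δ_{g₁+g₂} for all g₁, g₂ ∈ K[x], and Δ_g⁻¹ = Δ_{−g}. -/

import Mathlib

noncomputable section

open scoped Pointwise

variable (K : Type*) [Field K] [IsAlgClosed K] [CharZero K] (lam : K)

/-- `P_λ`: the quotient of `K[X,Y,Z]` by the ideal generated by `4XZ + Y² - λ`. -/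
abbrev PQ : Type _ :=
  MvPolynomial (Fin 3) K ⧸
    Ideal.span {4 * MvPolynomial.X 0 * MvPolynomial.X 2 + MvPolynomial.X 1 ^ 2 -
      MvPolynomial.C lam}

/-- `e`, the image of `X`. -/
def pe : PQ K lam := Ideal.Quotient.mk _ (MvPolynomial.X 0)

/-- `h`, the image of `Y`. -/
def ph : PQ K lam := Ideal.Quotient.mk _ (MvPolynomial.X 1)

/-- `f`, the image of `Z`. -/
def pf : PQ K lam := Ideal.Quotient.mk _ (MvPolynomial.X 2)

/-- A Poisson bracket on `P_λ`: a `K`-bilinear Lie bracket satisfying the Leibniz rule with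
`{e,f} = h`, `{h,e} = 2e`, `{h,f} = -2f`. -/
structure PoissonBr : Type _ where
  br : PQ K lam → PQ K lam → PQ K lam
  add_left : ∀ a b c, br (a + b) c = br a c + br b c
  add_right : ∀ a b c, br a (b + c) = br a b + br a c
  smul_left : ∀ (μ : K) (a b), br (μ • a) b = μ • br a b
  smul_right : ∀ (μ : K) (a b), br a (μ • b) = μ • br a b
  alternate : ∀ a, br a a = 0
  jacobi : ∀ a b c, br a (br b c) + br b (br c a) + br c (br a b) = 0
  leibniz : ∀ a b c, br a (b * c) = b * br a c + br a b * c
  br_ef : br (pe K lam) (pf K lam) = ph K lam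
  br_he : br (ph K lam) (pe K lam) = 2 * pe K lam
  br_hf : br (ph K lam) (pf K lam) = -2 * pf K lam

variable {K lam}

/-- `Aut(P_λ)`: the subgroup of `K`-algebra automorphisms of `P_λ` preserving the bracket.
Multiplication is composition: `(θ * φ) x = θ (φ x)`. -/
def PAut (B : PoissonBr K lam) : Subgroup ((PQ K lam) ≃ₐ[K] (PQ K lam)) where
  carrier := {φ | ∀ a b, φ (B.br a b) = B.br (φ a) (φ b)}
  one_mem' := fun _ _ => rfl
  mul_mem' := by
    intro φ ψ hφ hψ a b
    show φ (ψ (B.br a b)) = _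
    rw [hψ, hφ]
    rfl
  inv_mem' := by
    intro φ hφ a b
    apply φ.injective
    show φ (φ.symm (B.br a b)) = φ (B.br (φ.symm a) (φ.symm b))
    rw [hφ]
    simp

/-- `D` is the automorphism `Δ_g`:
`e ↦ e − g(f)h − f·g(f)²`, `h ↦ h + 2f·g(f)`, `f ↦ f`. -/
def IsDelta (B : PoissonBr K lam) (g : Polynomial K) (D : ↥(PAut B)) : Prop :=
  D.val (pe K lam) =
      pe K lam - Polynomial.aeval (pf K lam) g * ph K lam -
        pf K lam * Polynomial.aeval (pf K lam) g ^ 2 ∧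
  D.val (ph K lam) = ph K lam + 2 * (pf K lam * Polynomial.aeval (pf K lam) g) ∧
  D.val (pf K lam) = pf K lam

/-- `D` is the automorphism `τ`: `e ↦ f`, `h ↦ -h`, `f ↦ e`. -/
def IsTau (B : PoissonBr K lam) (D : ↥(PAut B)) : Prop :=
  D.val (pe K lam) = pf K lam ∧ D.val (ph K lam) = -ph K lam ∧ D.val (pf K lam) = pe K lam

/-- `D` is the automorphism `τ_α`: `e ↦ f`, `h ↦ -h + 2αf`, `f ↦ e + αh - α²f`. -/
def IsTauA (B : PoissonBr K lam) (α : K) (D : ↥(PAut B)) : Prop :=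
  D.val (pe K lam) = pf K lam ∧
  D.val (ph K lam) = -ph K lam + (2 * α) • pf K lam ∧
  D.val (pf K lam) = pe K lam + α • ph K lam - α ^ 2 • pf K lam

/-- `D` is the hyperbolic rotation `H_β`: `e ↦ βe`, `h ↦ h`, `f ↦ β⁻¹f`. -/
def IsHRot (B : PoissonBr K lam) (β : Kˣ) (D : ↥(PAut B)) : Prop :=
  D.val (pe K lam) = (β : K) • pe K lam ∧
  D.val (ph K lam) = ph K lam ∧
  D.val (pf K lam) = (β : K)⁻¹ • pf K lam

/-- The set `C` of linear triangular automorphisms: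
`e ↦ βe + αh − (α²/β)f`, `h ↦ h − (2α/β)f`, `f ↦ β⁻¹f` with `α ∈ K`, `β ∈ Kˣ`. -/
def CsetLT (B : PoissonBr K lam) : Set ↥(PAut B) :=
  {D | ∃ (α : K) (β : Kˣ),
    D.val (pe K lam) = (β : K) • pe K lam + α • ph K lam - (α ^ 2 / (β : K)) • pf K lam ∧
    D.val (ph K lam) = ph K lam - (2 * α / (β : K)) • pf K lam ∧
    D.val (pf K lam) = (β : K)⁻¹ • pf K lam}

section

variable {k : Type*} [Field k] {lm : k}

namespace PQ

theorem induction_on {P : PQ k lm → Prop} (a : PQ k lm)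
    (algebraMap : ∀ c : k, P (algebraMap k _ c))
    (e : P (pe k lm)) (h : P (ph k lm)) (f : P (pf k lm))
    (add : ∀ a b, P a → P b → P (a + b)) (mul : ∀ a b, P a → P b → P (a * b)) : P a := by
  obtain ⟨p, rfl⟩ := Ideal.Quotient.mk_surjective a
  induction p using MvPolynomial.induction_on with
  | C c => exact algebraMap c
  | add p q hp hq => rw [map_add]; exact add _ _ hp hq
  | mul_X p i hp =>
    rw [map_mul]
    refine mul _ _ hp ?_
    fin_cases i
    exacts [e, h, f]

theorem algHom_ext {A : Type*} [Semiring A] [Algebra k A] {φ ψ : PQ k lm →ₐ[k] A}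
    (he : φ (pe k lm) = ψ (pe k lm)) (hh : φ (ph k lm) = ψ (ph k lm))
    (hf : φ (pf k lm) = ψ (pf k lm)) : φ = ψ := by
  ext a
  induction a using PQ.induction_on with
  | algebraMap c => simp only [AlgHom.commutes]
  | e => exact he
  | h => exact hh
  | f => exact hf
  | add a b ha hb => rw [map_add, map_add, ha, hb]
  | mul a b ha hb => rw [map_mul, map_mul, ha, hb]

theorem relation :
    4 * pe k lm * pf k lm + ph k lm ^ 2 - algebraMap k (PQ k lm) lm = 0 :=
  Ideal.Quotient.eq_zero_iff_mem.mpr (Ideal.subset_span rfl)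

/-- The algebra map out of `P_λ` given by images of `e`, `h`, `f` satisfying the relation. -/
def lift {A : Type*} [CommRing A] [Algebra k A] (x y z : A)
    (hxyz : 4 * x * z + y ^ 2 - algebraMap k A lm = 0) : PQ k lm →ₐ[k] A :=
  Ideal.Quotient.liftₐ _ (MvPolynomial.aeval ![x, y, z]) fun a ha => by
    refine (Ideal.span_le (I := RingHom.ker (MvPolynomial.aeval ![x, y, z])).mpr ?_) ha
    rw [Set.singleton_subset_iff]
    simpa [RingHom.mem_ker] using hxyz

section

variable {A : Type*} [CommRing A] [Algebra k A] (x y z : A)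
  (hxyz : 4 * x * z + y ^ 2 - algebraMap k A lm = 0)

@[simp] theorem lift_e : lift x y z hxyz (pe k lm) = x :=
  MvPolynomial.aeval_X ![x, y, z] 0

@[simp] theorem lift_h : lift x y z hxyz (ph k lm) = y :=
  MvPolynomial.aeval_X ![x, y, z] 1

@[simp] theorem lift_f : lift x y z hxyz (pf k lm) = z :=
  MvPolynomial.aeval_X ![x, y, z] 2

end

end PQ

namespace PoissonBr

variable (B : PoissonBr k lm)

/-- The Hamiltonian derivation `{a, -}`. -/
def ham (a : PQ k lm) : Derivation k (PQ k lm) (PQ k lm) :=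
  Derivation.mk'
    { toFun := B.br a
      map_add' := B.add_right a
      map_smul' := fun μ b => B.smul_right μ a b }
    fun b c => by
      simp only [LinearMap.coe_mk, AddHom.coe_mk, smul_eq_mul, B.leibniz, mul_comm c]

theorem skew (a b : PQ k lm) : B.br a b = -B.br b a := by
  have := B.alternate (a + b)
  rw [B.add_left, B.add_right, B.add_right, B.alternate, B.alternate] at this
  linear_combination this

theorem sub_right (a b c : PQ k lm) : B.br a (b - c) = B.br a b - B.br a c :=
  map_sub (B.ham a) b c

theorem sub_left (a b c : PQ k lm) : B.br (a - b) c = B.br a c - B.br b c := by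
  rw [B.skew, B.sub_right, B.skew c a, B.skew c b]
  ring

theorem br_mul_left (a b c : PQ k lm) : B.br (a * b) c = a * B.br b c + B.br a c * b := by
  rw [B.skew, B.leibniz, B.skew c a, B.skew c b]
  ring

theorem br_algebraMap_right (a : PQ k lm) (c : k) : B.br a (algebraMap k _ c) = 0 :=
  (B.ham a).map_algebraMap c

theorem br_ofNat_right (a : PQ k lm) (n : ℕ) [n.AtLeastTwo] :
    B.br a (OfNat.ofNat n) = 0 := by
  rw [← map_ofNat (algebraMap k (PQ k lm)) n, br_algebraMap_right]

theorem br_ofNat_left (a : PQ k lm) (n : ℕ) [n.AtLeastTwo] :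
    B.br (OfNat.ofNat n) a = 0 := by
  rw [B.skew, br_ofNat_right, neg_zero]

theorem br_aeval_right (a b : PQ k lm) (g : Polynomial k) :
    B.br a (Polynomial.aeval b g) =
      Polynomial.aeval b (Polynomial.derivative g) * B.br a b :=
  (B.ham a).map_aeval g b

theorem map_br_of_map_br_generators (φ : PQ k lm →ₐ[k] PQ k lm)
    (hef : φ (B.br (pe k lm) (pf k lm)) = B.br (φ (pe k lm)) (φ (pf k lm)))
    (hhe : φ (B.br (ph k lm) (pe k lm)) = B.br (φ (ph k lm)) (φ (pe k lm)))
    (hhf : φ (B.br (ph k lm) (pf k lm)) = B.br (φ (ph k lm)) (φ (pf k lm)))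
    (a b : PQ k lm) : φ (B.br a b) = B.br (φ a) (φ b) := by
  have swap {a b : PQ k lm} (hab : φ (B.br a b) = B.br (φ a) (φ b)) :
      φ (B.br b a) = B.br (φ b) (φ a) := by
    rw [B.skew, map_neg, hab, ← B.skew]
  have self (a : PQ k lm) : φ (B.br a a) = B.br (φ a) (φ a) := by
    rw [B.alternate, B.alternate, map_zero]
  have extend (a : PQ k lm)
      (he : φ (B.br a (pe k lm)) = B.br (φ a) (φ (pe k lm)))
      (hh : φ (B.br a (ph k lm)) = B.br (φ a) (φ (ph k lm)))
      (hf : φ (B.br a (pf k lm)) = B.br (φ a) (φ (pf k lm))) (b : PQ k lm) :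
      φ (B.br a b) = B.br (φ a) (φ b) := by
    induction b using PQ.induction_on with
    | algebraMap c => rw [AlgHom.commutes, B.br_algebraMap_right, B.br_algebraMap_right, map_zero]
    | e => exact he
    | h => exact hh
    | f => exact hf
    | add b c hb hc => rw [B.add_right, map_add, map_add, B.add_right, hb, hc]
    | mul b c hb hc =>
      rw [B.leibniz, map_add, map_mul, map_mul, map_mul, B.leibniz, hb, hc]
  exact extend a (swap (extend _ (self _) (swap hhe) hef a))
    (swap (extend _ hhe (self _) hhf a)) (swap (extend _ (swap hef) (swap hhf) (self _) a)) b

end PoissonBr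

/-- The algebra endomorphism of `P_λ` underlying `Δ_g`. -/
def deltaHom (g : Polynomial k) : PQ k lm →ₐ[k] PQ k lm :=
  PQ.lift
    (pe k lm - Polynomial.aeval (pf k lm) g * ph k lm -
      pf k lm * Polynomial.aeval (pf k lm) g ^ 2)
    (ph k lm + 2 * (pf k lm * Polynomial.aeval (pf k lm) g))
    (pf k lm)
    (by linear_combination PQ.relation (k := k) (lm := lm))

@[simp] theorem deltaHom_e (g : Polynomial k) :
    deltaHom g (pe k lm) = pe k lm - Polynomial.aeval (pf k lm) g * ph k lm -
      pf k lm * Polynomial.aeval (pf k lm) g ^ 2 := PQ.lift_e _ _ _ _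

@[simp] theorem deltaHom_h (g : Polynomial k) :
    deltaHom g (ph k lm) =
      ph k lm + 2 * (pf k lm * Polynomial.aeval (pf k lm) g) := PQ.lift_h _ _ _ _

@[simp] theorem deltaHom_f (g : Polynomial k) : deltaHom g (pf k lm) = pf k lm :=
  PQ.lift_f _ _ _ _

theorem deltaHom_zero : deltaHom 0 = AlgHom.id k (PQ k lm) :=
  PQ.algHom_ext (by simp) (by simp) (by simp)

theorem deltaHom_comp (g₁ g₂ : Polynomial k) :
    (deltaHom g₁).comp (deltaHom g₂) = (deltaHom (g₁ + g₂) : PQ k lm →ₐ[k] PQ k lm) := by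
  refine PQ.algHom_ext ?_ ?_ ?_ <;>
    simp only [AlgHom.comp_apply, deltaHom_e, deltaHom_h, deltaHom_f, map_sub, map_add, map_mul,
      map_pow, map_ofNat, ← Polynomial.aeval_algHom_apply] <;>
    ring

theorem deltaHom_br (B : PoissonBr k lm) (g : Polynomial k) (a b : PQ k lm) :
    deltaHom g (B.br a b) = B.br (deltaHom g a) (deltaHom g b) := by
  have hfe : B.br (pf k lm) (pe k lm) = -ph k lm := by rw [B.skew, B.br_ef]
  have hfh : B.br (pf k lm) (ph k lm) = 2 * pf k lm := by rw [B.skew, B.br_hf]; ring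
  have aeval_left (c : PQ k lm) : B.br (Polynomial.aeval (pf k lm) g) c =
      Polynomial.aeval (pf k lm) (Polynomial.derivative g) * B.br (pf k lm) c := by
    rw [B.skew, B.br_aeval_right, B.skew c]
    ring
  refine B.map_br_of_map_br_generators _ ?_ ?_ ?_ a b <;>
    simp only [deltaHom_e, deltaHom_h, deltaHom_f, B.br_ef, B.br_he, B.br_hf, hfe, hfh,
      B.add_left, B.sub_right, B.sub_left, pow_two, B.leibniz, B.br_mul_left,
      B.br_ofNat_left, B.br_aeval_right, aeval_left, B.alternate, map_mul,
      map_neg, map_ofNat] <;>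
    ring

/-- The algebra automorphism of `P_λ` underlying `Δ_g`. -/
def deltaEquiv (g : Polynomial k) : PQ k lm ≃ₐ[k] PQ k lm :=
  AlgEquiv.ofAlgHom (deltaHom g) (deltaHom (-g))
    (by rw [deltaHom_comp, add_neg_cancel, deltaHom_zero])
    (by rw [deltaHom_comp, neg_add_cancel, deltaHom_zero])

theorem IsDelta.toAlgHom_eq {B : PoissonBr k lm} {g : Polynomial k} {D : ↥(PAut B)}
    (hD : IsDelta B g D) : (D.val : PQ k lm →ₐ[k] PQ k lm) = deltaHom g :=
  PQ.algHom_ext (hD.1.trans (deltaHom_e g).symm) (hD.2.1.trans (deltaHom_h g).symm)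
    (hD.2.2.trans (deltaHom_f g).symm)

theorem IsDelta.apply_eq {B : PoissonBr k lm} {g : Polynomial k} {D : ↥(PAut B)}
    (hD : IsDelta B g D) (a : PQ k lm) : D.val a = deltaHom g a :=
  DFunLike.congr_fun hD.toAlgHom_eq a

end

/-- For every `g ∈ K[x]` there is a unique automorphism `Δ_g ∈ Aut(P_λ)` with
`Δ_g(e) = e − g(f)h − f·g(f)²`, `Δ_g(h) = h + 2f·g(f)`, `Δ_g(f) = f`; moreover
`Δ_{g₁}∘Δ_{g₂} = Δ_{g₁+g₂}` and `Δ_g⁻¹ = Δ_{−g}`. -/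
theorem delta_exists_unique_and_comp (B : PoissonBr K lam) :
    (∀ g : Polynomial K, ∃! D : ↥(PAut B), IsDelta B g D) ∧
    (∀ Δ : Polynomial K → ↥(PAut B), (∀ g, IsDelta B g (Δ g)) →
      (∀ g₁ g₂ : Polynomial K, Δ g₁ * Δ g₂ = Δ (g₁ + g₂)) ∧
      (∀ g : Polynomial K, (Δ g)⁻¹ = Δ (-g))) := by
  refine ⟨fun g => ⟨⟨deltaEquiv g, deltaHom_br B g⟩, ⟨deltaHom_e g, deltaHom_h g, deltaHom_f g⟩,
    fun D hD => Subtype.ext (AlgEquiv.ext hD.apply_eq)⟩, fun Δ hΔ => ?_⟩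
  have hmul (g₁ g₂ : Polynomial K) : Δ g₁ * Δ g₂ = Δ (g₁ + g₂) := by
    refine Subtype.ext (AlgEquiv.ext fun a => ?_)
    rw [(hΔ (g₁ + g₂)).apply_eq, ← deltaHom_comp, AlgHom.comp_apply, ← (hΔ g₂).apply_eq,
      ← (hΔ g₁).apply_eq]
    rfl
  refine ⟨hmul, fun g => inv_eq_of_mul_eq_one_right ?_⟩
  have h0 : Δ 0 = 1 := by
    have := hmul 0 0
    rwa [add_zero, mul_eq_left] at this
  rw [hmul, add_neg_cancel, h0]
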